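/- arXiv:2110.13294 — 2 statements merged into one kernel-verified Lean document; each statement's English description precedes it below -/
import Mathlib

section
/- If the Löwenheim–Skolem–Tarski number LST(L^I) of the Härtig quantifier logic exists, then it is strictly larger than the Löwenheim number ℓ_I of L^I. -/
open Cardinal

/-- Formulas of the Härtig quantifier logic `L^I`, over the canonical countable
purely relational vocabulary in which, for each natural number `r`, there is a
relation symbol `r` that may be applied to any finite list of variables (so the
arity is determined by the application).  Variables are indexed by natural
numbers.  Since every sentence mentions only finitely many symbols, validity,
satisfiability, the Löwenheim number etc. for `L^I` over arbitrary vocabularies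
coincide with the corresponding notions for this canonical vocabulary. -/
inductive HForm : Type where
  | falsum : HForm
  | eq : ℕ → ℕ → HForm
  | rel : ℕ → List ℕ → HForm
  | imp : HForm → HForm → HForm
  | all : ℕ → HForm → HForm
  /-- `hartig i j φ ψ` is the Härtig (equicardinality) quantifier
  `I xᵢ xⱼ φ(xᵢ) ψ(xⱼ)`. -/
  | hartig : ℕ → ℕ → HForm → HForm → HForm

namespace HForm

/-- The free variables of an `L^I`-formula. -/
def freeVars : HForm → Finset ℕ
  | falsum => ∅
  | eq i j => {i, j}
  | rel _ l => l.toFinset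
  | imp f g => f.freeVars ∪ g.freeVars
  | all i f => f.freeVars \ {i}
  | hartig i j f g => (f.freeVars \ {i}) ∪ (g.freeVars \ {j})

/-- A sentence is a formula with no free variables. -/
def IsSentence (φ : HForm) : Prop := φ.freeVars = ∅

end HForm

/-- An interpretation of the canonical relational vocabulary on a domain `M`:
each relation symbol `r` is interpreted as a predicate on finite tuples. -/
def Interp (M : Type u) : Type u := ℕ → List M → Prop

/-- Satisfaction for the Härtig quantifier logic `L^I`: `HSat R φ v` says that
the structure `(M, R)` satisfies `φ` under the valuation `v`.  The clause for
the Härtig quantifier `I xᵢ xⱼ φ ψ` says exactly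
`|{a : φ(a)}| = |{a : ψ(a)}|`. -/
def HSat {M : Type u} (R : Interp M) : HForm → (ℕ → M) → Prop
  | .falsum, _ => False
  | .eq i j, v => v i = v j
  | .rel r l, v => R r (l.map v)
  | .imp f g, v => HSat R f v → HSat R g v
  | .all i f, v => ∀ a : M, HSat R f (Function.update v i a)
  | .hartig i j f g, v =>
      #{a : M // HSat R f (Function.update v i a)} =
      #{a : M // HSat R g (Function.update v j a)}

/-- `φ` holds in the structure `(M, R)`. -/
def HModels (M : Type u) (R : Interp M) (φ : HForm) : Prop :=
  ∀ v : ℕ → M, HSat R φ v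

/-- `φ` has a model (models are nonempty structures). -/
def HSatisfiable (φ : HForm) : Prop :=
  ∃ (M : Type) (_ : Nonempty M) (R : Interp M), HModels M R φ

/-- `φ` is valid: it holds in every (nonempty) structure. -/
def HValid (φ : HForm) : Prop :=
  ∀ (M : Type) (_ : Nonempty M) (R : Interp M), HModels M R φ

/-- `κ` is a Löwenheim bound for `L^I`: every satisfiable `L^I`-sentence has a
model of cardinality at most `κ`. -/
def LoewenheimBound (κ : Cardinal.{0}) : Prop :=
  ∀ φ : HForm, φ.IsSentence → HSatisfiable φ →
    ∃ (M : Type) (_ : Nonempty M) (R : Interp M), #M ≤ κ ∧ HModels M R φ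

/-- The Löwenheim number `ℓ_I` of the Härtig quantifier logic `L^I`: the least
cardinal `κ` such that every `L^I`-sentence having a model has a model of
cardinality `≤ κ`. -/
noncomputable def ellI : Cardinal := sInf {κ : Cardinal | LoewenheimBound κ}


/-- The restriction of an interpretation to a subset of the domain. -/
def Interp.restrict {M : Type u} (R : Interp M) (N : Set M) : Interp N :=
  fun r l => R r (l.map Subtype.val)

/-- `κ` is a Löwenheim–Skolem–Tarski bound for `L^I`: every (nonempty)
structure has an `L^I`-elementary substructure of cardinality `< κ`. -/
def LSTBound (κ : Cardinal.{0}) : Prop :=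
  ∀ (M : Type) (_ : Nonempty M) (R : Interp M),
    ∃ N : Set M, N.Nonempty ∧ #N < κ ∧
      ∀ (φ : HForm) (v : ℕ → N),
        HSat (R.restrict N) φ v ↔ HSat R φ (fun n => (v n : M))

/-- The Löwenheim–Skolem–Tarski number of `L^I`, i.e. the least LST bound
(junk value if there is no such bound). -/
noncomputable def lstI : Cardinal := sInf {κ : Cardinal | LSTBound κ}

namespace HForm

/-- A code for formulas, witnessing that there are only countably many of them. -/
def code : HForm → ℕ
  | falsum => Nat.pair 0 0
  | eq i j => Nat.pair 1 (Nat.pair i j)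
  | rel r l => Nat.pair 2 (Nat.pair r (Encodable.encode l))
  | imp f g => Nat.pair 3 (Nat.pair f.code g.code)
  | all i f => Nat.pair 4 (Nat.pair i f.code)
  | hartig i j f g => Nat.pair 5 (Nat.pair (Nat.pair i j) (Nat.pair f.code g.code))

theorem code_injective : Function.Injective code := by
  intro f
  induction f with
  | falsum => intro g h; cases g <;> simp_all [code, Nat.pair_eq_pair]
  | eq i j => intro g h; cases g <;> simp_all [code, Nat.pair_eq_pair]
  | rel r l => intro g h; cases g <;> simp_all [code, Nat.pair_eq_pair]
  | imp f₁ f₂ ih₁ ih₂ =>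
    intro g h
    cases g <;> simp only [code, Nat.pair_eq_pair] at h <;> try omega
    rw [ih₁ h.2.1, ih₂ h.2.2]
  | all i f ih =>
    intro g h
    cases g <;> simp only [code, Nat.pair_eq_pair] at h <;> try omega
    rw [h.2.1, ih h.2.2]
  | hartig i j f₁ f₂ ih₁ ih₂ =>
    intro g h
    cases g <;> simp only [code, Nat.pair_eq_pair] at h <;> try omega
    rw [h.2.1.1, h.2.1.2, ih₁ h.2.2.1, ih₂ h.2.2.2]

/-- Conjunction. -/
def and (f g : HForm) : HForm := imp (imp f (imp g falsum)) falsum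

/-- The formula saying that `xᵢ` lies in the `c`-th distinguished subset. -/
def guard (c i : ℕ) : HForm := rel (Nat.pair c 0) [i]

/-- Relativization of a formula to the `c`-th distinguished subset, with the relation symbols
renamed into the `c`-th copy of the vocabulary. -/
def relativize (c : ℕ) : HForm → HForm
  | falsum => falsum
  | eq i j => eq i j
  | rel r l => rel (Nat.pair c (r + 1)) l
  | imp f g => imp (f.relativize c) (g.relativize c)
  | all i f => all i (imp (guard c i) (f.relativize c))
  | hartig i j f g =>
      hartig i j (and (guard c i) (f.relativize c)) (and (guard c j) (g.relativize c))

end HForm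

theorem hSat_and {A : Type*} (S : Interp A) (f g : HForm) (v : ℕ → A) :
    HSat S (f.and g) v ↔ HSat S f v ∧ HSat S g v := by
  simp [HForm.and, HSat]

theorem hSat_guard_update {A : Type*} (S : Interp A) (c i : ℕ) (v : ℕ → A) (a : A) :
    HSat S (HForm.guard c i) (Function.update v i a) ↔ S (Nat.pair c 0) [a] := by
  simp [HForm.guard, HSat]

/-- Satisfaction of a relativized formula is satisfaction in the distinguished subset. -/
theorem hSat_relativize {A B : Type} (S : Interp A) (T : Interp B) (c : ℕ) (e : B → A)
    (he : Function.Injective e) (hrange : ∀ a, S (Nat.pair c 0) [a] ↔ a ∈ Set.range e)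
    (hT : ∀ r l, T r l ↔ S (Nat.pair c (r + 1)) (l.map e)) (φ : HForm) (v : ℕ → B) :
    HSat S (φ.relativize c) (e ∘ v) ↔ HSat T φ v := by
  have key (f : HForm) (ih : ∀ v : ℕ → B, HSat S (f.relativize c) (e ∘ v) ↔ HSat T f v)
      (i : ℕ) (v : ℕ → B) :
      #{a : A // HSat S (HForm.and (HForm.guard c i) (f.relativize c))
        (Function.update (e ∘ v) i a)} = #{b : B // HSat T f (Function.update v i b)} := by
    have hset : {a : A | HSat S (HForm.and (HForm.guard c i) (f.relativize c))
        (Function.update (e ∘ v) i a)} = e '' {b : B | HSat T f (Function.update v i b)} := by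
      ext a
      simp only [Set.mem_ofPred_eq, hSat_and, hSat_guard_update, hrange, Set.mem_image]
      constructor
      · rintro ⟨⟨b, rfl⟩, h⟩
        rw [← Function.comp_update, ih] at h
        exact ⟨b, h, rfl⟩
      · rintro ⟨b, h, rfl⟩
        rw [← Function.comp_update, ih]
        exact ⟨⟨b, rfl⟩, h⟩
    exact (congrArg (fun s : Set A => #s) hset).trans (Cardinal.mk_image_eq he)
  induction φ generalizing v with
  | falsum => rfl
  | eq i j => exact he.eq_iff
  | rel r l => simp [HForm.relativize, HSat, hT]
  | imp f g ihf ihg => simp only [HForm.relativize, HSat, ihf, ihg]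
  | all i f ih =>
    simp only [HForm.relativize, HSat, hSat_guard_update, hrange]
    simp only [Set.forall_mem_range, ← Function.comp_update, ih]
  | hartig i j f g ihf ihg =>
    simp only [HForm.relativize, HSat]
    rw [key f ihf, key g ihg]

/-- The disjoint union of a family of structures, the one with index `k` being interpreted in the
`c k`-th copy of the vocabulary. -/
def sigmaInterp {K : Type} (c : K → ℕ) (M : K → Type) (R : ∀ k, Interp (M k)) :
    Interp (Σ k, M k) := fun s l =>
  ((Nat.unpair s).2 = 0 ∧ ∃ k x, c k = (Nat.unpair s).1 ∧ l = [⟨k, x⟩]) ∨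
  ∃ r k, ∃ l' : List (M k), (Nat.unpair s).2 = r + 1 ∧ c k = (Nat.unpair s).1 ∧
    l = l'.map (Sigma.mk k) ∧ R k r l'

theorem sigmaInterp_guard {K : Type} {c : K → ℕ} (hc : Function.Injective c) {M : K → Type}
    (R : ∀ k, Interp (M k)) (k : K) (a : Σ k, M k) :
    sigmaInterp c M R (Nat.pair (c k) 0) [a] ↔ a ∈ Set.range (Sigma.mk k) := by
  simp only [sigmaInterp, Nat.unpair_pair]
  constructor
  · rintro (⟨-, k', x, hk, h⟩ | ⟨r, -, -, h, -⟩)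
    · obtain rfl := hc hk
      exact ⟨x, (List.singleton_inj.mp h).symm⟩
    · omega
  · rintro ⟨x, rfl⟩
    exact Or.inl ⟨trivial, k, x, rfl, rfl⟩

theorem sigmaInterp_rel {K : Type} {c : K → ℕ} (hc : Function.Injective c) {M : K → Type}
    (R : ∀ k, Interp (M k)) (k : K) (r : ℕ) (l : List (M k)) :
    R k r l ↔ sigmaInterp c M R (Nat.pair (c k) (r + 1)) (l.map (Sigma.mk k)) := by
  simp only [sigmaInterp, Nat.unpair_pair]
  constructor
  · exact fun h => Or.inr ⟨r, k, l, rfl, rfl, rfl, h⟩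
  · rintro (⟨h, -⟩ | ⟨r', k', l', hr, hk, hl, h⟩)
    · omega
    · obtain rfl := hc hk
      obtain rfl : r = r' := by omega
      rwa [List.map_injective_iff.mpr sigma_mk_injective hl]

/-- Every LST bound strictly exceeds some Löwenheim bound: apply it to the disjoint union of
models of all satisfiable sentences. -/
theorem LSTBound.exists_loewenheimBound_lt {κ : Cardinal.{0}} (hκ : LSTBound κ) :
    ∃ μ < κ, LoewenheimBound μ := by
  let K := {φ : HForm // HSatisfiable φ}
  let c : K → ℕ := fun φ => φ.1.code
  have hc : Function.Injective c := HForm.code_injective.comp Subtype.val_injective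
  choose M hM R hR using fun φ : K => φ.2
  let S := sigmaInterp c M R
  let k₀ : K := ⟨.imp .falsum .falsum, Unit, ⟨()⟩, fun _ _ => True, fun _ h => h⟩
  obtain ⟨N, ⟨x₀, hx₀⟩, hlt, hN⟩ := hκ (Σ k, M k) ⟨⟨k₀, (hM k₀).some⟩⟩ S
  refine ⟨#N, hlt, fun φ _ hφ => ?_⟩
  let k : K := ⟨φ, hφ⟩
  let D := {a : N // S.restrict N (Nat.pair (c k) 0) [a]}
  let T : Interp D := fun r l => S.restrict N (Nat.pair (c k) (r + 1)) (l.map Subtype.val)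
  have hD : Nonempty D := by
    by_contra hempty
    have hall : HSat (S.restrict N) (.all 0 (.imp (HForm.guard (c k) 0) .falsum))
        (fun _ => ⟨x₀, hx₀⟩) := by
      intro a ha
      rw [hSat_guard_update] at ha
      exact hempty ⟨a, ha⟩
    refine (hN _ _).mp hall ⟨k, (hM k).some⟩ ?_
    rw [hSat_guard_update]
    exact (sigmaInterp_guard hc R k _).mpr ⟨_, rfl⟩
  refine ⟨D, hD, T, mk_subtype_le _, fun v => ?_⟩
  rw [← hSat_relativize (S.restrict N) T (c k) Subtype.val Subtype.val_injective
    (fun a => ⟨fun h => ⟨⟨a, h⟩, rfl⟩, by rintro ⟨b, rfl⟩; exact b.2⟩)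
    (fun _ _ => Iff.rfl), hN]
  choose w hw using fun n => (sigmaInterp_guard hc R k _).mp (v n).2
  have hvw : (fun n => (((Subtype.val ∘ v) n : N) : Σ k, M k)) = Sigma.mk k ∘ w :=
    funext fun n => (hw n).symm
  rw [hvw, hSat_relativize S (R k) (c k) _ sigma_mk_injective (sigmaInterp_guard hc R k)
    (sigmaInterp_rel hc R k)]
  exact hR k w

/-- If the Löwenheim–Skolem–Tarski number `LST(L^I)` of the
Härtig quantifier logic exists, then it is strictly larger than the Löwenheim
number `ℓ_I` of `L^I`. -/
theorem ellI_lt_lstI (h : {κ : Cardinal | LSTBound κ}.Nonempty) : ellI < lstI := by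
  obtain ⟨μ, hlt, hμ⟩ := LSTBound.exists_loewenheimBound_lt (csInf_mem h)
  exact (csInf_le' hμ).trans_lt hlt
end

section
/- The class K of structures (A, <) such that < well-orders A is Δ(L^I)-definable: both K and its complement within the class of all {<}-structures are classes of relativized reducts of model classes of L^I-sentences. In particular, an ordered set (A, <) is a well-order if and only if it is a relativized reduct of a model of the conjunction θ of: (1) '< linearly orders A'; (2) ∀x∀y∀z (x < y → (R(x,z) → R(y,z))); (3) ∀x∀y (x < y → ¬ Iuv R(x,u) R(y,v)). -/
open Cardinal

/-- `(A, r)` is a relativized reduct of a model of the `L^I`-sentence `φ`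
(in the canonical vocabulary, where the binary relation symbol `0` plays the
role of `<` and the unary relation symbol `1` plays the role of the
relativizing predicate): there is a model `(B, R)` of `φ` and an injection
`e : A → B` whose range is the interpretation of the relativizing predicate,
such that `r` is the pullback of the interpretation of `<`. -/
def IsRelativizedReduct (A : Type) (r : A → A → Prop) (φ : HForm) : Prop :=
  ∃ (B : Type) (R : Interp B) (e : A → B),
    Function.Injective e ∧
    (∀ b : B, R 1 [b] ↔ b ∈ Set.range e) ∧
    (∀ a a' : A, r a a' ↔ R 0 [e a, e a']) ∧
    HModels B R φ

/-- A class `C` of structures `(A, <)` in the vocabulary of one binary relation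
is `Σ(L^I)`-definable if it is the class of relativized reducts of the models
of some `L^I`-sentence `φ` (in a larger vocabulary). -/
def SigmaLI (C : ∀ A : Type, (A → A → Prop) → Prop) : Prop :=
  ∃ φ : HForm, φ.IsSentence ∧
    ∀ (A : Type) (_ : Nonempty A) (r : A → A → Prop),
      C A r ↔ IsRelativizedReduct A r φ

/-- A class `C` of structures `(A, <)` is `Δ(L^I)`-definable if both `C` and
its complement (within the class of all `{<}`-structures) are
`Σ(L^I)`-definable. -/
def DeltaLI (C : ∀ A : Type, (A → A → Prop) → Prop) : Prop :=
  SigmaLI C ∧ SigmaLI (fun A r => ¬ C A r)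

namespace HForm

/-- Negation. -/
def neg (f : HForm) : HForm := imp f falsum

/-- Conjunction. -/
def conj (f g : HForm) : HForm := neg (imp f (neg g))

/-- Disjunction. -/
def disj (f g : HForm) : HForm := imp (neg f) g

/-- The atomic formula `xᵢ < xⱼ`. -/
def lt (i j : ℕ) : HForm := rel 0 [i, j]

/-- The atomic formula saying that `xᵢ` lies in the relativizing predicate. -/
def dom (i : ℕ) : HForm := rel 1 [i]

/-- `<` is irreflexive on the relativizing predicate. -/
def irreflexive : HForm := all 0 (imp (dom 0) (neg (lt 0 0)))

/-- `<` is transitive on the relativizing predicate. -/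
def transitive : HForm :=
  all 0 (all 1 (all 2 (imp (dom 0) (imp (dom 1) (imp (dom 2)
    (imp (lt 0 1) (imp (lt 1 2) (lt 0 2))))))))

/-- `<` is trichotomous on the relativizing predicate. -/
def trichotomous : HForm :=
  all 0 (all 1 (imp (dom 0) (imp (dom 1) (disj (lt 0 1) (disj (eq 0 1) (lt 1 0))))))

/-- The sections of relation `2` increase along `<`. -/
def sectionsMono : HForm :=
  all 0 (all 1 (all 2 (imp (lt 0 1) (imp (rel 2 [0, 2]) (rel 2 [1, 2])))))

/-- The sections of relation `2` at points related by `<` have distinct cardinalities. -/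
def sectionsCard : HForm :=
  all 0 (all 1 (imp (lt 0 1) (neg (hartig 2 3 (rel 2 [0, 2]) (rel 2 [1, 3])))))

/-- `<` linearly orders the relativizing predicate, and the sections of relation `2` increase
along `<` and change cardinality at each step. -/
def wellOrder : HForm :=
  conj irreflexive (conj transitive (conj trichotomous (conj sectionsMono sectionsCard)))

/-- If `<` is trichotomous on the relativizing predicate, then the predicate `2` is a nonempty
subset of it without a minimal element. -/
def notWellOrder : HForm :=
  imp trichotomous (conj (neg (all 0 (neg (rel 2 [0]))))
    (all 0 (imp (rel 2 [0])
      (conj (dom 0) (neg (all 1 (imp (rel 2 [1]) (neg (lt 1 0)))))))))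

theorem isSentence_wellOrder : wellOrder.IsSentence := by
  unfold IsSentence
  decide

theorem isSentence_notWellOrder : notWellOrder.IsSentence := by
  unfold IsSentence
  decide

end HForm

theorem hModels_wellOrder {B : Type u} [Nonempty B] (R : Interp B) :
    HModels B R .wellOrder ↔
      (∀ b, R 1 [b] → ¬ R 0 [b, b]) ∧
      (∀ b₁ b₂ b₃, R 1 [b₁] → R 1 [b₂] → R 1 [b₃] →
        R 0 [b₁, b₂] → R 0 [b₂, b₃] → R 0 [b₁, b₃]) ∧
      (∀ b₁ b₂, R 1 [b₁] → R 1 [b₂] → R 0 [b₁, b₂] ∨ b₁ = b₂ ∨ R 0 [b₂, b₁]) ∧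
      (∀ x y z, R 0 [x, y] → R 2 [x, z] → R 2 [y, z]) ∧
      (∀ x y, R 0 [x, y] → #{z : B // R 2 [x, z]} ≠ #{z : B // R 2 [y, z]}) := by
  simp [HModels, HForm.wellOrder, HForm.irreflexive, HForm.transitive, HForm.trichotomous,
    HForm.sectionsMono, HForm.sectionsCard, HForm.conj, HForm.disj, HForm.neg, HForm.lt,
    HForm.dom, HSat, Function.update, or_iff_not_imp_left]

theorem hModels_notWellOrder {B : Type u} [Nonempty B] (R : Interp B) :
    HModels B R .notWellOrder ↔
      ((∀ b₁ b₂, R 1 [b₁] → R 1 [b₂] → R 0 [b₁, b₂] ∨ b₁ = b₂ ∨ R 0 [b₂, b₁]) →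
        (∃ b, R 2 [b]) ∧
        ∀ b, R 2 [b] → R 1 [b] ∧ ∃ c, R 2 [c] ∧ R 0 [c, b]) := by
  simp [HModels, HForm.notWellOrder, HForm.trichotomous, HForm.conj, HForm.disj, HForm.neg,
    HForm.lt, HForm.dom, HSat, Function.update, or_iff_not_imp_left]

/-- A trichotomous relation is a well-order if it increases the cardinality of some
monotone family of sets. -/
theorem isWellOrder_of_sections {A : Type*} {B : Type u} {r : A → A → Prop} {S : A → B → Prop}
    (tri : ∀ a b, r a b ∨ a = b ∨ r b a)
    (mono : ∀ a b z, r a b → S a z → S b z)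
    (card : ∀ a b, r a b → #{z : B // S a z} ≠ #{z : B // S b z}) :
    IsWellOrder A r where
  trichotomous a b hab hba := by
    have := tri a b
    tauto
  wf := by
    refine Subrelation.wf (r := InvImage (· < ·) fun a => #{z : B // S a z}) ?_
      (InvImage.wf _ Cardinal.lt_wf)
    intro a b hab
    exact lt_of_le_of_ne (mk_subtype_mono fun z => mono a b z hab) (card a b hab)

/-- Every well-order indexes a family of initial segments of strictly increasing cardinality. -/
theorem exists_sections_of_isWellOrder (A : Type u) (r : A → A → Prop) [IsWellOrder A r] :
    ∃ (C : Type u) (S : A → C → Prop),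
      (∀ a b z, r a b → S a z → S b z) ∧
      ∀ a b, r a b → #{z : C // S a z} ≠ #{z : C // S b z} := by
  have h (a : A) : (ℵ_ (Ordinal.typein r a)).ord <
      Ordinal.type (α := (ℵ_ (Ordinal.type r)).ord.ToType) (· < ·) := by
    rw [Ordinal.type_toType, ord_lt_ord, aleph_lt_aleph]
    exact Ordinal.typein_lt_type r a
  refine ⟨(ℵ_ (Ordinal.type r)).ord.ToType, fun a z => z < Ordinal.enum (· < ·) ⟨_, h a⟩,
    fun a b z hab hz => hz.trans ?_, fun a b hab => ?_⟩
  · refine Ordinal.enum_lt_enum.2 (Subtype.coe_lt_coe.1 ?_)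
    exact ord_lt_ord.2 (aleph_lt_aleph.2 ((Ordinal.typein_lt_typein r).2 hab))
  · have hcard (a : A) : #{z // z < Ordinal.enum (· < ·) ⟨_, h a⟩} = ℵ_ (Ordinal.typein r a) := by
      rw [← Ordinal.card_typein (r := (· < ·)), Ordinal.typein_enum, card_ord]
    rw [hcard, hcard]
    exact (aleph_lt_aleph.2 ((Ordinal.typein_lt_typein r).2 hab)).ne

/-- The disjoint sum of a well-order with a family of sections, in relational form. -/
theorem exists_extension_of_isWellOrder (A : Type) (r : A → A → Prop) [IsWellOrder A r] :
    ∃ (B : Type) (e : A → B) (lt' S : B → B → Prop),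
      Function.Injective e ∧
      (∀ a a' : A, r a a' ↔ lt' (e a) (e a')) ∧
      (∀ b ∈ Set.range e, ¬ lt' b b) ∧
      (∀ b₁ ∈ Set.range e, ∀ b₂ ∈ Set.range e, ∀ b₃ ∈ Set.range e,
        lt' b₁ b₂ → lt' b₂ b₃ → lt' b₁ b₃) ∧
      (∀ b₁ ∈ Set.range e, ∀ b₂ ∈ Set.range e,
        lt' b₁ b₂ ∨ b₁ = b₂ ∨ lt' b₂ b₁) ∧
      (∀ x y z : B, lt' x y → S x z → S y z) ∧
      (∀ x y : B, lt' x y →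
        #{z : B // S x z} ≠ #{z : B // S y z}) := by
  obtain ⟨C, S, mono, card⟩ := exists_sections_of_isWellOrder A r
  have key (a : A) :
      #{z : A ⊕ C // Sum.elim (fun _ => False) (S a) z} = #{z : C // S a z} := by
    refine (mk_congr (Equiv.ofBijective
      (fun z : {z : C // S a z} =>
        (⟨Sum.inr z.1, z.2⟩ : {z : A ⊕ C // Sum.elim (fun _ => False) (S a) z})) ⟨?_, ?_⟩)).symm
    · rintro ⟨x, hx⟩ ⟨y, hy⟩ h
      exact Subtype.ext (Sum.inr_injective (congrArg Subtype.val h))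
    · rintro ⟨x | x, hx⟩
      · exact hx.elim
      · exact ⟨⟨x, hx⟩, rfl⟩
  refine ⟨A ⊕ C, Sum.inl,
    fun x y => Sum.elim (fun a => Sum.elim (r a) (fun _ => False) y) (fun _ => False) x,
    fun x z => Sum.elim (fun a => Sum.elim (fun _ => False) (S a) z) (fun _ => False) x,
    Sum.inl_injective, fun _ _ => Iff.rfl, ?_, ?_, ?_, ?_, ?_⟩
  · rintro _ ⟨a, rfl⟩
    exact irrefl_of r a
  · rintro _ ⟨a, rfl⟩ _ ⟨b, rfl⟩ _ ⟨c, rfl⟩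
    exact trans_of r
  · rintro _ ⟨a, rfl⟩ _ ⟨b, rfl⟩
    simpa using trichotomous_of r a b
  · rintro (x | x) (y | y) (z | z) <;> simp
    exact mono x y z
  · rintro (x | x) (y | y) h
    · have := card x y h
      rwa [← key x, ← key y] at this
    all_goals simp at h

theorem isWellOrder_iff_exists_extension (A : Type) (r : A → A → Prop) :
    IsWellOrder A r ↔
      ∃ (B : Type) (e : A → B) (lt' S : B → B → Prop),
        Function.Injective e ∧
        (∀ a a' : A, r a a' ↔ lt' (e a) (e a')) ∧
        (∀ b ∈ Set.range e, ¬ lt' b b) ∧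
        (∀ b₁ ∈ Set.range e, ∀ b₂ ∈ Set.range e, ∀ b₃ ∈ Set.range e,
          lt' b₁ b₂ → lt' b₂ b₃ → lt' b₁ b₃) ∧
        (∀ b₁ ∈ Set.range e, ∀ b₂ ∈ Set.range e,
          lt' b₁ b₂ ∨ b₁ = b₂ ∨ lt' b₂ b₁) ∧
        (∀ x y z : B, lt' x y → S x z → S y z) ∧
        (∀ x y : B, lt' x y →
          #{z : B // S x z} ≠ #{z : B // S y z}) := by
  refine ⟨fun h => exists_extension_of_isWellOrder A r, ?_⟩
  rintro ⟨B, e, lt', S, inj, hr, -, -, tri, mono, card⟩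
  refine isWellOrder_of_sections (S := fun a => S (e a)) (fun a b => ?_) (fun a b z hab => ?_)
    (fun a b hab => ?_)
  · simpa [hr, inj.eq_iff] using tri (e a) ⟨a, rfl⟩ (e b) ⟨b, rfl⟩
  · exact mono _ _ z ((hr a b).1 hab)
  · exact card _ _ ((hr a b).1 hab)

theorem isWellOrder_iff_isRelativizedReduct (A : Type) [Nonempty A] (r : A → A → Prop) :
    IsWellOrder A r ↔ IsRelativizedReduct A r .wellOrder := by
  rw [isWellOrder_iff_exists_extension]
  constructor
  · rintro ⟨B, e, lt', S, inj, hr, irr, tr, tri, mono, card⟩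
    have : Nonempty B := .map e ‹_›
    refine ⟨B, fun n l => match n, l with
      | 0, [x, y] => lt' x y
      | 1, [x] => x ∈ Set.range e
      | 2, [x, y] => S x y
      | _, _ => False, e, inj, fun _ => Iff.rfl, hr, (hModels_wellOrder _).2 ?_⟩
    exact ⟨irr, fun a b c ha hb hc => tr a ha b hb c hc, fun a b ha hb => tri a ha b hb,
      mono, card⟩
  · rintro ⟨B, R, e, inj, hU, hr, hM⟩
    have : Nonempty B := .map e ‹_›
    obtain ⟨irr, tr, tri, mono, card⟩ := (hModels_wellOrder R).1 hM
    simp only [hU] at irr tr tri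
    exact ⟨B, e, fun x y => R 0 [x, y], fun x y => R 2 [x, y], inj, hr, irr,
      fun a ha b hb c hc => tr a b c ha hb hc, fun a ha b hb => tri a b ha hb, mono, card⟩

theorem not_isWellOrder_iff_isRelativizedReduct (A : Type) [Nonempty A] (r : A → A → Prop) :
    ¬ IsWellOrder A r ↔ IsRelativizedReduct A r .notWellOrder := by
  constructor
  · intro h
    have key : (∀ a b, r a b ∨ a = b ∨ r b a) →
        ∃ P : Set A, P.Nonempty ∧ ∀ a ∈ P, ∃ b ∈ P, r b a := by
      intro tri
      by_contra! hP
      exact h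
        { wf := WellFounded.wellFounded_iff_has_min.2 hP
          trichotomous := fun a b hab hba => ((tri a b).resolve_left hab).resolve_right hba }
    by_cases tri : ∀ a b, r a b ∨ a = b ∨ r b a
    · obtain ⟨P, hP, hmin⟩ := key tri
      refine ⟨A, fun n l => match n, l with
        | 0, [x, y] => r x y
        | 1, [_] => True
        | 2, [x] => x ∈ P
        | _, _ => False, id, Function.injective_id, by simp, fun _ _ => Iff.rfl,
        (hModels_notWellOrder _).2 fun _ => ⟨hP, fun b hb => ⟨trivial, hmin b hb⟩⟩⟩
    · refine ⟨A, fun n l => match n, l with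
        | 0, [x, y] => r x y
        | 1, [_] => True
        | _, _ => False, id, Function.injective_id, by simp, fun _ _ => Iff.rfl,
        (hModels_notWellOrder _).2 fun h => (tri fun a b => h a b trivial trivial).elim⟩
  · rintro ⟨B, R, e, inj, hU, hr, hM⟩ h
    have : Nonempty B := .map e ‹_›
    obtain ⟨⟨b, hb⟩, hP⟩ := (hModels_notWellOrder R).1 hM fun x y hx hy => by
      obtain ⟨a, rfl⟩ := (hU x).1 hx
      obtain ⟨a', rfl⟩ := (hU y).1 hy
      simpa [hr, inj.eq_iff] using trichotomous_of r a a'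
    obtain ⟨a, rfl⟩ := (hU b).1 (hP b hb).1
    obtain ⟨m, hm, hmin⟩ := h.wf.has_min {a | R 2 [e a]} ⟨a, hb⟩
    obtain ⟨c, hc, hcm⟩ := (hP _ hm).2
    obtain ⟨c, rfl⟩ := (hU c).1 (hP c hc).1
    exact hmin c hc ((hr _ _).2 hcm)

/-- The class of structures `(A, <)` such that `<` well-orders
`A` is `Δ(L^I)`-definable.  In particular, `(A, <)` is a well-order if and only
if it is a relativized reduct of a model of the conjunction `θ` of:
(1) `<` linearly orders `A`;
(2) `∀x∀y∀z (x < y → (R(x,z) → R(y,z)))`;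
(3) `∀x∀y (x < y → ¬ I u v R(x,u) R(y,v))`. -/
theorem wellOrder_DeltaLI :
    DeltaLI (fun A r => IsWellOrder A r) ∧
    ∀ (A : Type) (r : A → A → Prop),
      IsWellOrder A r ↔
        ∃ (B : Type) (e : A → B) (lt' S : B → B → Prop),
          Function.Injective e ∧
          (∀ a a' : A, r a a' ↔ lt' (e a) (e a')) ∧
          -- (1): `lt'` linearly orders the set `A` (i.e. the range of `e`)
          (∀ b ∈ Set.range e, ¬ lt' b b) ∧
          (∀ b₁ ∈ Set.range e, ∀ b₂ ∈ Set.range e, ∀ b₃ ∈ Set.range e,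
            lt' b₁ b₂ → lt' b₂ b₃ → lt' b₁ b₃) ∧
          (∀ b₁ ∈ Set.range e, ∀ b₂ ∈ Set.range e,
            lt' b₁ b₂ ∨ b₁ = b₂ ∨ lt' b₂ b₁) ∧
          -- (2): `∀x∀y∀z (x < y → (R(x,z) → R(y,z)))`
          (∀ x y z : B, lt' x y → S x z → S y z) ∧
          -- (3): `∀x∀y (x < y → ¬ I u v R(x,u) R(y,v))`
          (∀ x y : B, lt' x y →
            #{z : B // S x z} ≠ #{z : B // S y z}) := by
  exact ⟨⟨⟨.wellOrder, HForm.isSentence_wellOrder, fun A _ r =>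
      isWellOrder_iff_isRelativizedReduct A r⟩,
    ⟨.notWellOrder, HForm.isSentence_notWellOrder, fun A _ r =>
      not_isWellOrder_iff_isRelativizedReduct A r⟩⟩,
    isWellOrder_iff_exists_extension⟩
end
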